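/- For a nonsingular Gaussian target π, the dimensional-LSI majorant is exact: J_KL^↓(U_r) := (1/2)[trace(U_⊥^T M(π) U_⊥) − (d−r) + ln det(U_⊥^T H(π) U_⊥)] equals D_KL(π || π̃^KL(U_r)) for every orthonormal U_r, where M(π) = E_π[XX^T], H(π) = C(π)^{−1} is the Fisher information, and π̃^KL(U_r) is the optimal-profile approximation with reference μ = N(0,I_d). -/

import Mathlib

open Matrix MeasureTheory

/-- The density of the Gaussian measure `N(m, C)` on `ℝ^d` with respect to Lebesgue measure. -/
noncomputable def gaussDensity (d : ℕ) (m : Fin d → ℝ) (C : Matrix (Fin d) (Fin d) ℝ)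
    (x : Fin d → ℝ) : ℝ :=
  (Real.sqrt ((2 * Real.pi) ^ d * C.det))⁻¹ *
    Real.exp (-(1 / 2) * ((x - m) ⬝ᵥ (C⁻¹ *ᵥ (x - m))))

noncomputable abbrev phi (x : ℝ) : ℝ := ProbabilityTheory.gaussianPDFReal 0 1 x

lemma phi_int0 : ∫ x, phi x = 1 :=
  ProbabilityTheory.integral_gaussianPDFReal_eq_one 0 one_ne_zero

lemma phi_int1 : ∫ x, x * phi x = 0 := by
  have h := ProbabilityTheory.integral_id_gaussianReal (μ := 0) (v := 1)
  rw [ProbabilityTheory.integral_gaussianReal_eq_integral_smul one_ne_zero] at h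
  simpa [mul_comm] using h

lemma phi_int2 : ∫ x, x * x * phi x = 1 := by
  have h := ProbabilityTheory.variance_id_gaussianReal (μ := 0) (v := 1)
  rw [ProbabilityTheory.variance_eq_sub (by exact_mod_cast ProbabilityTheory.memLp_id_gaussianReal 2)] at h
  simp only [id_eq, ProbabilityTheory.integral_id_gaussianReal] at h
  rw [ProbabilityTheory.integral_gaussianReal_eq_integral_smul one_ne_zero] at h
  simp only [Pi.pow_apply, id_eq, smul_eq_mul] at h
  simp only [NNReal.coe_one] at h
  rw [← h]
  simp only [ne_eq, OfNat.ofNat_ne_zero, not_false_eq_true, zero_pow, sub_zero]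
  congr 1; ext x; ring

lemma phi_i0 : Integrable phi := ProbabilityTheory.integrable_gaussianPDFReal 0 1
lemma phi_i2 : Integrable (fun x => x * x * phi x) :=
  Integrable.of_integral_ne_zero (by rw [phi_int2]; exact one_ne_zero)
lemma phi_i1 : Integrable (fun x => x * phi x) := by
  have := (integrable_mul_exp_neg_mul_sq (b := 1/2) (by norm_num)).const_mul (√(2 * Real.pi))⁻¹
  refine this.congr (Filter.Eventually.of_forall fun x => ?_)
  simp only [phi, ProbabilityTheory.gaussianPDFReal, NNReal.coe_one, mul_one, sub_zero]
  rw [show -(1/2) * x^2 = -x^2/2 by ring]; ring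

noncomputable def Phi {d : ℕ} (y : Fin d → ℝ) : ℝ := ∏ i, phi (y i)

lemma Phi_eq {d : ℕ} (y : Fin d → ℝ) :
    Phi y = (√((2 * Real.pi) ^ d))⁻¹ * Real.exp (-(1/2) * (y ⬝ᵥ y)) := by
  simp only [Phi, phi, ProbabilityTheory.gaussianPDFReal, Finset.prod_mul_distrib, ← Real.exp_sum]
  congr 1
  · have h : √((2 * Real.pi) ^ d) = √(2 * Real.pi) ^ d := by
      rw [Real.sqrt_eq_iff_mul_self_eq (by positivity) (by positivity), ← mul_pow,
        Real.mul_self_sqrt Real.two_pi_pos.le]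
    rw [h]
    simp only [NNReal.coe_one, mul_one, Finset.prod_const, Finset.card_univ, Fintype.card_fin, inv_pow]
  · congr 1
    simp only [dotProduct, Finset.mul_sum]
    refine Finset.sum_congr rfl fun i _ => ?_
    simp; ring

lemma Phi0 (d : ℕ) : Integrable (fun y : Fin d → ℝ => Phi y) ∧ ∫ y : Fin d → ℝ, Phi y = 1 := by
  constructor
  · exact Integrable.fintype_prod (f := fun _ => phi) (fun _ => phi_i0)
  · simp only [Phi]
    rw [integral_fintype_prod_volume_eq_prod (fun (_ : Fin d) => phi)]
    simp [phi_int0]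

lemma Phi1 (d : ℕ) (i : Fin d) : Integrable (fun y : Fin d → ℝ => y i * Phi y) ∧
    ∫ y : Fin d → ℝ, y i * Phi y = 0 := by
  have e : (fun y : Fin d → ℝ => y i * Phi y) =
      fun y => ∏ k, (fun (k : Fin d) (x : ℝ) => (if k = i then x else 1) * phi x) k (y k) := by
    ext y
    simp only [Finset.prod_mul_distrib]
    simp [Phi]
  rw [e]
  clear e
  constructor
  · refine Integrable.fintype_prod (f := (fun (k : Fin d) (x : ℝ) => (if k = i then x else 1) * phi x)) fun k => ?_
    by_cases h : k = i
    · simpa [h] using phi_i1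
    · simpa [h] using phi_i0
  · rw [integral_fintype_prod_volume_eq_prod (fun (k : Fin d) (x : ℝ) => (if k = i then x else 1) * phi x)]
    refine Finset.prod_eq_zero (Finset.mem_univ i) ?_
    simpa using phi_int1

lemma Phi2 (d : ℕ) (i j : Fin d) : Integrable (fun y : Fin d → ℝ => y i * y j * Phi y) ∧
    ∫ y : Fin d → ℝ, y i * y j * Phi y = if i = j then 1 else 0 := by
  have e : (fun y : Fin d → ℝ => y i * y j * Phi y) =
      fun y => ∏ k, (fun (k : Fin d) (x : ℝ) => (if k = i then x else 1) * (if k = j then x else 1) * phi x) k (y k) := by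
    ext y
    simp only [Finset.prod_mul_distrib]
    simp [Phi]
  rw [e]
  clear e
  constructor
  · refine Integrable.fintype_prod (f := (fun (k : Fin d) (x : ℝ) => (if k = i then x else 1) * (if k = j then x else 1) * phi x)) fun k => ?_
    by_cases h : k = i <;> by_cases h' : k = j
    · simpa only [if_pos h, if_pos h'] using phi_i2
    · simpa only [if_pos h, if_neg h', mul_one] using phi_i1
    · simpa only [if_neg h, if_pos h', one_mul] using phi_i1
    · simpa only [if_neg h, if_neg h', one_mul] using phi_i0
  · rw [integral_fintype_prod_volume_eq_prod (fun (k : Fin d) (x : ℝ) => (if k = i then x else 1) * (if k = j then x else 1) * phi x)]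
    by_cases hij : i = j
    · rw [if_pos hij]
      refine Finset.prod_eq_one fun k _ => ?_
      subst hij
      by_cases h : k = i
      · simpa only [if_pos h] using phi_int2
      · simpa only [if_neg h, one_mul] using phi_int0
    · rw [if_neg hij]
      refine Finset.prod_eq_zero (Finset.mem_univ i) ?_
      simpa only [if_true, if_neg hij, mul_one] using phi_int1

lemma Phi_quad (d : ℕ) (k : ℝ) (v : Fin d → ℝ) (B : Matrix (Fin d) (Fin d) ℝ) :
    ∫ y : Fin d → ℝ, (k + v ⬝ᵥ y + y ⬝ᵥ (B *ᵥ y)) * Phi y = k + B.trace := by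
  have e : (fun y : Fin d → ℝ => (k + v ⬝ᵥ y + y ⬝ᵥ (B *ᵥ y)) * Phi y) = fun y =>
      (k * Phi y + ∑ i, v i * (y i * Phi y)) + ∑ i, ∑ j, B i j * (y i * y j * Phi y) := by
    ext y
    simp only [dotProduct, mulVec, add_mul, Finset.sum_mul, Finset.mul_sum]
    congr 1
    · congr 1
      exact Finset.sum_congr rfl fun i _ => by ring
    · exact Finset.sum_congr rfl fun i _ => Finset.sum_congr rfl fun j _ => by ring
  have i0 := (Phi0 d).1.const_mul k
  have i1 : ∀ i ∈ Finset.univ, Integrable (fun y : Fin d → ℝ => v i * (y i * Phi y)) :=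
    fun i _ => (Phi1 d i).1.const_mul _
  have i2 : ∀ i, ∀ j ∈ Finset.univ, Integrable (fun y : Fin d → ℝ => B i j * (y i * y j * Phi y)) :=
    fun i j _ => (Phi2 d i j).1.const_mul _
  have i2' : ∀ i ∈ Finset.univ, Integrable (fun y : Fin d → ℝ => ∑ j, B i j * (y i * y j * Phi y)) :=
    fun i _ => integrable_finsetSum _ (i2 i)
  have i01 : Integrable (fun y : Fin d → ℝ => k * Phi y + ∑ i, v i * (y i * Phi y)) :=
    i0.add (integrable_finsetSum _ i1)
  rw [e, integral_add i01 (integrable_finsetSum _ i2'),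
    integral_add i0 (integrable_finsetSum _ i1), integral_finsetSum _ i1, integral_finsetSum _ i2']
  simp_rw [integral_finsetSum _ (i2 _), integral_const_mul, (Phi0 d).2, (Phi1 d _).2, (Phi2 d _ _).2]
  simp [trace]

lemma change_var {d : ℕ} (m : Fin d → ℝ) (S : Matrix (Fin d) (Fin d) ℝ) (hS : S.det ≠ 0)
    (g : (Fin d → ℝ) → ℝ) : ∫ x, g x = ∫ y, |S.det| * g (S *ᵥ y + m) := by
  have hu : IsUnit S := (Matrix.isUnit_iff_isUnit_det _).2 (isUnit_iff_ne_zero.2 hS)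
  have inj : Function.Injective (fun y => S *ᵥ y + m) := fun a b h =>
    (Matrix.mulVec_injective_of_isUnit hu) (add_right_cancel h)
  have surj : Function.Surjective (fun y => S *ᵥ y + m) := fun x => by
    obtain ⟨y, hy⟩ := (Matrix.mulVec_surjective_iff_isUnit.2 hu) (x - m)
    exact ⟨y, by simp [hy]⟩
  have := integral_image_eq_integral_abs_det_fderiv_smul volume MeasurableSet.univ
    (f := fun y => S *ᵥ y + m) (f' := fun _ => (toLin' S).toContinuousLinearMap)
    (fun x _ => ((toLin' S).toContinuousLinearMap.hasFDerivAt.add_const m).hasFDerivWithinAt)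
    inj.injOn g
  rw [Set.image_univ, surj.range_eq, setIntegral_univ, setIntegral_univ] at this
  rw [this]
  simp [ContinuousLinearMap.det, LinearMap.det_toLin']

section
variable {d r s : ℕ} {C : Matrix (Fin d) (Fin d) ℝ}
  {Ur : Matrix (Fin d) (Fin r) ℝ} {Up : Matrix (Fin d) (Fin s) ℝ}

lemma sig_eq (hUr : Urᵀ * Ur = 1) :
    1 + Ur * Urᵀ * (C - 1) * (Ur * Urᵀ) = 1 + Ur * ((Urᵀ * C * Ur - 1) * Urᵀ) := by
  have : Ur * Urᵀ * (C - 1) * (Ur * Urᵀ) = Ur * ((Urᵀ * C * Ur - Urᵀ * Ur) * Urᵀ) := by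
    simp only [Matrix.mul_sub, Matrix.sub_mul, Matrix.mul_assoc, Matrix.mul_one]
  rw [this, hUr]

lemma sig_det (hUr : Urᵀ * Ur = 1) :
    (1 + Ur * Urᵀ * (C - 1) * (Ur * Urᵀ)).det = (Urᵀ * C * Ur).det := by
  rw [sig_eq hUr, Matrix.det_one_add_mul_comm, Matrix.mul_assoc, hUr]
  simp

lemma sig_det' (hUr : Urᵀ * Ur = 1) :
    (Urᵀ * C * Ur).det = (1 + (C - 1) * (Ur * Urᵀ)).det := by
  rw [← Matrix.mul_assoc, Matrix.det_one_add_mul_comm]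
  simp [Matrix.mul_sub, Matrix.mul_one, Matrix.sub_mul, hUr, Matrix.mul_assoc]

lemma det_id (hC : IsUnit C.det) (hUr : Urᵀ * Ur = 1) (hUp : Upᵀ * Up = 1)
    (hc : Ur * Urᵀ + Up * Upᵀ = 1) :
    (Upᵀ * C⁻¹ * Up).det = C.det⁻¹ * (Urᵀ * C * Ur).det := by
  rw [sig_det' hUr, sig_det' hUp, ← Ring.inverse_eq_inv', ← Matrix.det_nonsing_inv, ← Matrix.det_mul]
  congr 1
  have : Up * Upᵀ = 1 - Ur * Urᵀ := by rw [← hc]; abel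
  rw [this]
  simp only [Matrix.mul_add, Matrix.sub_mul, Matrix.mul_sub, Matrix.mul_one, Matrix.one_mul,
    ← Matrix.mul_assoc, Matrix.nonsing_inv_mul _ hC]
  abel

lemma sig_inv (hA : IsUnit (Urᵀ * C * Ur).det) (hUr : Urᵀ * Ur = 1) (hUp : Upᵀ * Up = 1)
    (ho : Urᵀ * Up = 0) (hc : Ur * Urᵀ + Up * Upᵀ = 1) :
    (1 + Ur * Urᵀ * (C - 1) * (Ur * Urᵀ))⁻¹ = Ur * (Urᵀ * C * Ur)⁻¹ * Urᵀ + Up * Upᵀ := by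
  apply Matrix.inv_eq_right_inv
  rw [sig_eq hUr]
  generalize hAA : Urᵀ * C * Ur = A at *
  have e : 1 + Ur * ((A - 1) * Urᵀ) = Ur * A * Urᵀ + Up * Upᵀ := by
    rw [← hc]; simp only [Matrix.mul_sub, Matrix.sub_mul, Matrix.one_mul, Matrix.mul_assoc]; abel
  have ho' : Upᵀ * Ur = 0 := by simpa using congrArg transpose ho
  rw [e, ← hc]
  have h1 : Ur * A * Urᵀ * (Ur * A⁻¹ * Urᵀ) = Ur * (A * (Urᵀ * Ur) * A⁻¹) * Urᵀ := by
    simp only [Matrix.mul_assoc]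
  have h2 : Ur * A * Urᵀ * (Up * Upᵀ) = Ur * A * (Urᵀ * Up) * Upᵀ := by
    simp only [Matrix.mul_assoc]
  have h3 : Up * Upᵀ * (Ur * A⁻¹ * Urᵀ) = Up * (Upᵀ * Ur) * (A⁻¹ * Urᵀ) := by
    simp only [Matrix.mul_assoc]
  have h4 : Up * Upᵀ * (Up * Upᵀ) = Up * (Upᵀ * Up) * Upᵀ := by
    simp only [Matrix.mul_assoc]
  rw [Matrix.add_mul, Matrix.mul_add, Matrix.mul_add, h1, h2, h3, h4, ho, ho', hUr, hUp, Matrix.mul_one,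
    Matrix.mul_nonsing_inv _ hA]
  simp

lemma A_posDef (hC : C.PosDef) (hUr : Urᵀ * Ur = 1) : (Urᵀ * C * Ur).PosDef := by
  have := hC.conjTranspose_mul_mul_same (B := Ur) (fun a b h => by
    have := congrArg (Urᵀ *ᵥ ·) h
    simpa [Matrix.mulVec_mulVec, hUr] using this)
  simpa [conjTranspose_eq_transpose_of_trivial] using this

lemma tr_id (hA : IsUnit (Urᵀ * C * Ur).det) :
    ((Ur * (Urᵀ * C * Ur)⁻¹ * Urᵀ + Up * Upᵀ) * C).trace = r + (Upᵀ * C * Up).trace := by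
  rw [Matrix.add_mul, trace_add]
  congr 1
  · rw [Matrix.mul_assoc, Matrix.mul_assoc, Matrix.trace_mul_comm, Matrix.mul_assoc,
      Matrix.nonsing_inv_mul _ hA]; simp
  · rw [Matrix.mul_assoc, Matrix.trace_mul_comm]

lemma mean_id (m : Fin d → ℝ) (hUp : Upᵀ * Up = 1) (hUr : Urᵀ * Ur = 1)
    (ho : Urᵀ * Up = 0) (hc : Ur * Urᵀ + Up * Upᵀ = 1) (D : Matrix (Fin r) (Fin r) ℝ) :
    (m - Ur *ᵥ (Urᵀ *ᵥ m)) ⬝ᵥ ((Ur * D * Urᵀ + Up * Upᵀ) *ᵥ (m - Ur *ᵥ (Urᵀ *ᵥ m)))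
      = (Upᵀ * vecMulVec m m * Up).trace := by
  have e : m - Ur *ᵥ (Urᵀ *ᵥ m) = Up *ᵥ (Upᵀ *ᵥ m) := by
    have h : Ur *ᵥ (Urᵀ *ᵥ m) + Up *ᵥ (Upᵀ *ᵥ m) = m := by
      rw [Matrix.mulVec_mulVec, Matrix.mulVec_mulVec, ← Matrix.add_mulVec, hc, Matrix.one_mulVec]
    rw [sub_eq_iff_eq_add, add_comm, h]
  have k : (Ur * D * Urᵀ + Up * Upᵀ) * Up = Up := by
    rw [Matrix.add_mul, Matrix.mul_assoc, ho, Matrix.mul_assoc Up, hUp]; simp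
  rw [e, Matrix.mulVec_mulVec _ _ Up, k, Matrix.dotProduct_mulVec, Matrix.vecMul_mulVec]
  rw [Matrix.mul_vecMulVec, Matrix.vecMulVec_mul, Matrix.trace_vecMulVec]
  rw [← Matrix.mulVec_transpose, ← Matrix.mulVec_transpose, hUp]
  simp

lemma exists_sqrt (hC : C.PosDef) : ∃ S : Matrix (Fin d) (Fin d) ℝ, C = S * Sᵀ := by
  open scoped MatrixOrder in
  have h0 : 0 ≤ C := Matrix.nonneg_iff_posSemidef.2 hC.posSemidef
  have h1 := CFC.sqrt_mul_sqrt_self C h0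
  have h2 : IsSelfAdjoint (CFC.sqrt C) := (CFC.sqrt_nonneg C).isSelfAdjoint
  have h3 : (CFC.sqrt C)ᵀ = CFC.sqrt C := by
    rw [← conjTranspose_eq_transpose_of_trivial]; exact h2
  exact ⟨CFC.sqrt C, by rw [h3, h1]⟩
end


lemma gauss_dens {d : ℕ} (m : Fin d → ℝ) (S : Matrix (Fin d) (Fin d) ℝ) (hS : S.det ≠ 0)
    (y : Fin d → ℝ) :
    (S *ᵥ y) ⬝ᵥ ((S * Sᵀ)⁻¹ *ᵥ (S *ᵥ y)) = y ⬝ᵥ y ∧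
    |S.det| * gaussDensity d m (S * Sᵀ) (S *ᵥ y + m) = Phi y := by
  have hq : (S *ᵥ y) ⬝ᵥ ((S * Sᵀ)⁻¹ *ᵥ (S *ᵥ y)) = y ⬝ᵥ y := by
    have hu : IsUnit S.det := isUnit_iff_ne_zero.2 hS
    have hu' : IsUnit Sᵀ.det := by rwa [det_transpose]
    rw [Matrix.mul_inv_rev, Matrix.mulVec_mulVec, Matrix.mul_assoc, Matrix.nonsing_inv_mul _ hu,
      Matrix.mul_one, Matrix.dotProduct_mulVec, ← Matrix.mulVec_transpose, Matrix.mulVec_mulVec,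
      Matrix.transpose_nonsing_inv, Matrix.transpose_transpose, Matrix.nonsing_inv_mul _ hu,
      Matrix.one_mulVec]
  refine ⟨hq, ?_⟩
  rw [Phi_eq, gaussDensity, add_sub_cancel_right, hq, det_mul, det_transpose,
    Real.sqrt_mul (by positivity), Real.sqrt_mul_self_eq_abs]
  have : |S.det| ≠ 0 := abs_ne_zero.2 hS
  field_simp

lemma gauss_log {d : ℕ} (m : Fin d → ℝ) (C : Matrix (Fin d) (Fin d) ℝ) (hC : 0 < C.det)
    (x : Fin d → ℝ) :
    gaussDensity d m C x ≠ 0 ∧ Real.log (gaussDensity d m C x) =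
      -(1/2) * Real.log ((2 * Real.pi) ^ d) - (1/2) * Real.log C.det
        - (1/2) * ((x - m) ⬝ᵥ (C⁻¹ *ᵥ (x - m))) := by
  have hp : 0 < (2 * Real.pi) ^ d := by positivity
  have h1 : (√((2 * Real.pi) ^ d * C.det))⁻¹ ≠ 0 := by positivity
  constructor
  · rw [gaussDensity]; positivity
  · rw [gaussDensity, Real.log_mul h1 (Real.exp_ne_zero _), Real.log_exp, Real.log_inv,
      Real.log_sqrt (by positivity), Real.log_mul hp.ne' hC.ne']
    ring

lemma quad_expand {d : ℕ} (S K : Matrix (Fin d) (Fin d) ℝ) (b y : Fin d → ℝ) :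
    (S *ᵥ y + b) ⬝ᵥ (K *ᵥ (S *ᵥ y + b)) =
      b ⬝ᵥ (K *ᵥ b) + (Sᵀ *ᵥ (K *ᵥ b) + Sᵀ *ᵥ (Kᵀ *ᵥ b)) ⬝ᵥ y + y ⬝ᵥ ((Sᵀ * K * S) *ᵥ y) := by
  have h1 : ∀ w : Fin d → ℝ, (S *ᵥ y) ⬝ᵥ w = (Sᵀ *ᵥ w) ⬝ᵥ y := fun w => by
    rw [Matrix.mulVec_transpose, ← Matrix.dotProduct_mulVec, dotProduct_comm]
  have h2 : b ⬝ᵥ (K *ᵥ (S *ᵥ y)) = (Sᵀ *ᵥ (Kᵀ *ᵥ b)) ⬝ᵥ y := by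
    rw [Matrix.mulVec_transpose, Matrix.mulVec_transpose, ← Matrix.dotProduct_mulVec,
      ← Matrix.dotProduct_mulVec]
  rw [Matrix.mulVec_add, add_dotProduct, dotProduct_add, dotProduct_add, h1, h1, h2,
    Matrix.mulVec_mulVec, Matrix.mulVec_mulVec, add_dotProduct,
    dotProduct_comm ((Sᵀ * K * S) *ᵥ y)]
  ring

/-- For a nonsingular Gaussian target `π = N(m, C)` with reference `μ = N(0, I_d)`, the
dimensional-LSI majorant
`J_KL^↓(U_r) = (1/2)[tr(U_⊥ᵀ M(π) U_⊥) − (d−r) + ln det(U_⊥ᵀ H(π) U_⊥)]`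
(with `M(π) = C + m mᵀ` and `H(π) = C⁻¹`) is exactly the KL divergence
`D_KL(π ‖ π̃^KL(U_r))`, where `π̃^KL(U_r)` is Gaussian with mean `U_r U_rᵀ m` and
covariance `I_d + U_r U_rᵀ (C − I_d) U_r U_rᵀ`. -/
theorem dimensional_majorant_exact_gaussian (d r : ℕ) (hr : r ≤ d)
    (m : Fin d → ℝ) (C : Matrix (Fin d) (Fin d) ℝ) (hC : C.PosDef)
    (Ur : Matrix (Fin d) (Fin r) ℝ) (Up : Matrix (Fin d) (Fin (d - r)) ℝ)
    (hUr : Urᵀ * Ur = 1) (hUp : Upᵀ * Up = 1) (hortho : Urᵀ * Up = 0)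
    (hcomplete : Ur * Urᵀ + Up * Upᵀ = 1) :
    (1 / 2) * ((Upᵀ * (C + Matrix.vecMulVec m m) * Up).trace - ((d : ℝ) - r)
        + Real.log (Upᵀ * C⁻¹ * Up).det)
      = ∫ x : Fin d → ℝ,
          Real.log (gaussDensity d m C x /
            gaussDensity d (Ur *ᵥ (Urᵀ *ᵥ m))
              (1 + Ur * Urᵀ * (C - 1) * (Ur * Urᵀ)) x)
          * gaussDensity d m C x := by
  have hdC : 0 < C.det := hC.det_pos
  have hA := (A_posDef hC hUr).det_pos
  have hAu : IsUnit (Urᵀ * C * Ur).det := isUnit_iff_ne_zero.2 hA.ne'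
  have hdS := sig_det (C := C) hUr
  have hinv := sig_inv (C := C) hAu hUr hUp hortho hcomplete
  have htr := tr_id (Up := Up) (C := C) hAu
  have hmean := mean_id m hUp hUr hortho hcomplete (Urᵀ * C * Ur)⁻¹
  have hdet := det_id (isUnit_iff_ne_zero.2 hdC.ne') hUr hUp hcomplete
  generalize 1 + Ur * Urᵀ * (C - 1) * (Ur * Urᵀ) = Sg at hdS hinv ⊢
  generalize Ur * (Urᵀ * C * Ur)⁻¹ * Urᵀ + Up * Upᵀ = K at hinv htr hmean
  generalize hn : Ur *ᵥ (Urᵀ *ᵥ m) = n at hmean ⊢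
  obtain ⟨S, hS⟩ := exists_sqrt hC
  have hSd : S.det ≠ 0 := by
    intro h
    rw [hS, det_mul, h, zero_mul] at hdC
    exact lt_irrefl _ hdC
  have key : ∀ y : Fin d → ℝ, |S.det| * (Real.log (gaussDensity d m C (S *ᵥ y + m) /
        gaussDensity d n Sg (S *ᵥ y + m)) * gaussDensity d m C (S *ᵥ y + m)) =
      (((1/2) * (Real.log (Urᵀ * C * Ur).det - Real.log C.det + (m - n) ⬝ᵥ (K *ᵥ (m - n))))
        + ((1/2 : ℝ) • (Sᵀ *ᵥ (K *ᵥ (m - n)) + Sᵀ *ᵥ (Kᵀ *ᵥ (m - n)))) ⬝ᵥ y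
        + y ⬝ᵥ (((1/2 : ℝ) • (Sᵀ * K * S - 1)) *ᵥ y)) * Phi y := by
    intro y
    obtain ⟨g1, g2⟩ := gauss_dens m S hSd y
    rw [← hS] at g1 g2
    obtain ⟨l1, l2⟩ := gauss_log m C hdC (S *ᵥ y + m)
    obtain ⟨l3, l4⟩ := gauss_log n Sg (hdS ▸ hA) (S *ᵥ y + m)
    rw [mul_left_comm, g2, Real.log_div l1 l3, l2, l4, add_sub_cancel_right, g1, hinv, hdS,
      add_sub_assoc, quad_expand, Matrix.smul_mulVec, Matrix.sub_mulVec, Matrix.one_mulVec,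
      dotProduct_smul, dotProduct_sub, smul_dotProduct, smul_eq_mul, smul_eq_mul]
    ring
  have hT : (Sᵀ * K * S).trace = (K * C).trace := by
    rw [Matrix.mul_assoc, Matrix.trace_mul_comm Sᵀ, Matrix.mul_assoc K, ← hS]
  rw [change_var m S hSd]
  simp_rw [key]
  rw [Phi_quad, hmean, hdet, Real.log_mul (inv_ne_zero hdC.ne') hA.ne', Real.log_inv, trace_smul,
    trace_sub, trace_one, hT, htr,
    Matrix.mul_add, Matrix.add_mul, trace_add, Fintype.card_fin, smul_eq_mul]
  ring
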